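/- Let p, q, d be natural numbers with p ≥ 1, q ≥ 1 and p+q < d. Set p' := p/d, q' := q/d, and α := (log₂(d−q) − log₂ p) / ( log₂((d−p)(d−q)) − log₂(pq) ). Then the limit lim_{n→∞} (mrk(A(p,q,d)^{⊗n}))^{1/n} exists and equals d · max{ 2^{−D(1−α ‖ p')}, 2^{−D(α ‖ q')} }, where D(a‖b) := a·log₂(a/b) + (1−a)·log₂((1−a)/(1−b)). -/

import Mathlib

open Matrix

noncomputable def mrk {m n : Type*} [Fintype m] [Fintype n]
    (S : Submodule ℂ (Matrix m n ℂ)) : ℕ :=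
  sSup (Matrix.rank '' (S : Set (Matrix m n ℂ)))

noncomputable def tensorSpace {m₁ n₁ m₂ n₂ : Type*}
    (S : Submodule ℂ (Matrix m₁ n₁ ℂ)) (T : Submodule ℂ (Matrix m₂ n₂ ℂ)) :
    Submodule ℂ (Matrix (m₁ × m₂) (n₁ × n₂) ℂ) :=
  Submodule.span ℂ {M | ∃ A ∈ S, ∃ B ∈ T, M = Matrix.kroneckerMap (· * ·) A B}

noncomputable def tensorPow {d : ℕ} (S : Submodule ℂ (Matrix (Fin d) (Fin d) ℂ)) (n : ℕ) :
    Submodule ℂ (Matrix (Fin n → Fin d) (Fin n → Fin d) ℂ) :=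
  Submodule.span ℂ {M | ∃ A : Fin n → Matrix (Fin d) (Fin d) ℂ,
    (∀ k, A k ∈ S) ∧ M = fun i j => ∏ k, A k (i k) (j k)}

noncomputable def spaceImageOf {ι κ : Type*} [Fintype κ]
    (S : Submodule ℂ (Matrix ι κ ℂ)) (U : Submodule ℂ (κ → ℂ)) : Submodule ℂ (ι → ℂ) :=
  Submodule.span ℂ {v | ∃ A ∈ S, ∃ u ∈ U, v = A.mulVec u}

def HasShrunkSubspace {ι : Type*} [Fintype ι]
    (S : Submodule ℂ (Matrix ι ι ℂ)) : Prop :=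
  ∃ U : Submodule ℂ (ι → ℂ),
    Module.finrank ℂ (spaceImageOf S U) < Module.finrank ℂ U

noncomputable def compSpace (p q m n : ℕ) : Submodule ℂ (Matrix (Fin m) (Fin n) ℂ) where
  carrier := {A | ∀ (i : Fin m) (j : Fin n), p ≤ (i : ℕ) → q ≤ (j : ℕ) → A i j = 0}
  add_mem' := by
    intro a b ha hb i j hi hj
    simp only [Matrix.add_apply, ha i j hi hj, hb i j hi hj, add_zero]
  zero_mem' := by intro i j _ _; rfl
  smul_mem' := by
    intro c a ha i j hi hj
    simp only [Matrix.smul_apply, ha i j hi hj, smul_zero]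

noncomputable def binD (a b : ℝ) : ℝ :=
  a * Real.logb 2 (a / b) + (1 - a) * Real.logb 2 ((1 - a) / (1 - b))

open Filter Topology

section MatrixRank

lemma rank_add_le_rank_add_rank {m n : Type*} [Fintype m] [Fintype n]
    (A B : Matrix m n ℂ) : (A + B).rank ≤ A.rank + B.rank := by
  have h : LinearMap.range (A + B).mulVecLin ≤
      LinearMap.range A.mulVecLin ⊔ LinearMap.range B.mulVecLin := by
    rintro _ ⟨v, rfl⟩
    rw [Matrix.mulVecLin_add, LinearMap.add_apply]
    exact Submodule.add_mem_sup ⟨v, rfl⟩ ⟨v, rfl⟩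
  exact (Submodule.finrank_mono h).trans (Submodule.finrank_add_le_finrank_add_finrank _ _)

/-- A set of rows and a set of columns covering the support of a matrix bound its rank. -/
lemma rank_le_card_add_card {m n : Type*} [Fintype m] [Fintype n]
    (M : Matrix m n ℂ) (P : m → Prop) (Q : n → Prop) [DecidablePred P] [DecidablePred Q]
    (h : ∀ i j, ¬ P i → ¬ Q j → M i j = 0) :
    M.rank ≤ Fintype.card {i // P i} + Fintype.card {j // Q j} := by
  classical
  let D : Matrix m m ℂ := Matrix.diagonal fun i => if P i then 1 else 0
  let E : Matrix n n ℂ := Matrix.diagonal fun j => if Q j then 1 else 0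
  have hM : M = D * M + (M - D * M) * E := by
    ext i j
    by_cases hi : P i <;> by_cases hj : Q j <;>
      simp [D, E, Matrix.diagonal_mul, Matrix.mul_diagonal, hi, hj, h]
  have hD : D.rank = Fintype.card {i // P i} := by
    rw [Matrix.rank_diagonal]
    exact Fintype.card_congr (Equiv.subtypeEquivRight fun i => by simp)
  have hE : E.rank = Fintype.card {j // Q j} := by
    rw [Matrix.rank_diagonal]
    exact Fintype.card_congr (Equiv.subtypeEquivRight fun i => by simp)
  rw [← hD, ← hE]
  calc M.rank = (D * M + (M - D * M) * E).rank := by rw [← hM]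
    _ ≤ (D * M).rank + ((M - D * M) * E).rank := rank_add_le_rank_add_rank _ _
    _ ≤ D.rank + E.rank :=
      add_le_add (Matrix.rank_mul_le_left _ _) (Matrix.rank_mul_le_right _ _)

lemma rank_le_mrk {m n : Type*} [Fintype m] [Fintype n]
    {S : Submodule ℂ (Matrix m n ℂ)} {M : Matrix m n ℂ} (hM : M ∈ S) : M.rank ≤ mrk S :=
  le_csSup ⟨Fintype.card n, by rintro _ ⟨A, _, rfl⟩; exact A.rank_le_card_width⟩ ⟨M, hM, rfl⟩

lemma mrk_le {m n : Type*} [Fintype m] [Fintype n]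
    {S : Submodule ℂ (Matrix m n ℂ)} {c : ℕ} (h : ∀ M ∈ S, M.rank ≤ c) : mrk S ≤ c :=
  csSup_le ⟨_, 0, S.zero_mem, rfl⟩ (by rintro _ ⟨A, hA, rfl⟩; exact h A hA)

/-- A matching whose matrix units lie in a matrix space bounds its maximal rank below. -/
lemma card_le_mrk {ι m n : Type*} [Fintype ι] [Fintype m] [Fintype n]
    [DecidableEq m] [DecidableEq n] {S : Submodule ℂ (Matrix m n ℂ)}
    (r : ι → m) (c : ι → n) (hr : Function.Injective r) (hc : Function.Injective c)
    (h : ∀ a, Matrix.single (r a) (c a) (1 : ℂ) ∈ S) : Fintype.card ι ≤ mrk S := by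
  classical
  let M : Matrix m n ℂ := ∑ a, Matrix.single (r a) (c a) (1 : ℂ)
  have hsub : M.submatrix r c = 1 := by
    ext a b
    simp only [M, Matrix.submatrix_apply, Matrix.sum_apply, Matrix.single_apply, hr.eq_iff,
      hc.eq_iff, Matrix.one_apply]
    by_cases hab : a = b
    · subst hab; simp
    · rw [if_neg hab]
      exact Finset.sum_eq_zero fun x _ => if_neg fun hx => hab (hx.1.symm.trans hx.2)
  calc Fintype.card ι = (M.submatrix r c).rank := by rw [hsub, Matrix.rank_one]
    _ ≤ M.rank := Matrix.rank_submatrix_le M r c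
    _ ≤ mrk S := rank_le_mrk (Submodule.sum_mem _ fun a _ => h a)

end MatrixRank

section Support

variable {p q d n : ℕ}

lemma apply_eq_zero_of_mem_tensorPow_compSpace
    {M : Matrix (Fin n → Fin d) (Fin n → Fin d) ℂ}
    (hM : M ∈ tensorPow (compSpace p q d d) n) {i j : Fin n → Fin d} {k : Fin n}
    (hi : p ≤ (i k : ℕ)) (hj : q ≤ (j k : ℕ)) : M i j = 0 := by
  induction hM using Submodule.span_induction with
  | mem M hM =>
    obtain ⟨A, hA, rfl⟩ := hM
    exact Finset.prod_eq_zero (Finset.mem_univ k) (hA k _ _ hi hj)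
  | zero => rfl
  | add A B _ _ hA hB => rw [Matrix.add_apply, hA, hB, add_zero]
  | smul c A _ hA => rw [Matrix.smul_apply, hA, smul_zero]

lemma single_mem_tensorPow_compSpace {i j : Fin n → Fin d}
    (h : ∀ k, (i k : ℕ) < p ∨ (j k : ℕ) < q) :
    Matrix.single i j (1 : ℂ) ∈ tensorPow (compSpace p q d d) n := by
  refine Submodule.subset_span ⟨fun k => Matrix.single (i k) (j k) 1, fun k a b ha hb => ?_, ?_⟩
  · refine Matrix.single_apply_of_ne _ _ _ _ _ ?_
    rintro ⟨rfl, rfl⟩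
    rcases h k with h | h <;> omega
  · ext a b
    simp only [Matrix.single_apply, Finset.prod_ite_zero, Finset.prod_const_one]
    simp [funext_iff, forall_and]

/-- The number of words whose set of positions with letters satisfying `P` is `x`. -/
lemma card_positions_eq (P : Fin d → Prop) [DecidablePred P] (x : Finset (Fin n)) :
    Fintype.card {i : Fin n → Fin d // Finset.univ.filter (fun k => P (i k)) = x} =
      Fintype.card {a // P a} ^ x.card * Fintype.card {a // ¬ P a} ^ (n - x.card) := by
  classical
  rw [Fintype.card_subtype]
  have h : (Finset.univ.filter fun i : Fin n → Fin d =>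
      Finset.univ.filter (fun k => P (i k)) = x) =
      Fintype.piFinset fun k => Finset.univ.filter fun a => (P a ↔ k ∈ x) := by
    ext i
    simp [Finset.ext_iff]
  rw [h, Fintype.card_piFinset, ← Finset.prod_mul_prod_compl x,
    Finset.prod_congr rfl (g := fun _ => Fintype.card {a // P a}),
    Finset.prod_congr (s₁ := xᶜ) rfl (g := fun _ => Fintype.card {a // ¬ P a})]
  · simp [Finset.card_compl]
  · intro k hk
    simp [Finset.mem_compl.1 hk, Fintype.card_subtype]
  · intro k hk
    simp [hk, Fintype.card_subtype]

lemma card_val_lt (hp : p ≤ d) : Fintype.card {a : Fin d // (a : ℕ) < p} = p := by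
  rw [Fintype.card_subtype, Fin.card_filter_val_lt, min_eq_right hp]

lemma card_not_val_lt (hp : p ≤ d) : Fintype.card {a : Fin d // ¬ (a : ℕ) < p} = d - p := by
  rw [Fintype.card_subtype_compl, card_val_lt hp, Fintype.card_fin]

/-- The positions of `i` carrying letters below `p`. -/
def lowPositions (p : ℕ) (i : Fin n → Fin d) : Finset (Fin n) :=
  Finset.univ.filter fun k => (i k : ℕ) < p

/-- The positions of `j` carrying letters at least `q`. -/
def highPositions (q : ℕ) (j : Fin n → Fin d) : Finset (Fin n) :=
  Finset.univ.filter fun k => ¬ (j k : ℕ) < q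

lemma card_lowPositions_eq (hp : p ≤ d) (x : Finset (Fin n)) :
    Fintype.card {i : Fin n → Fin d // lowPositions p i = x} =
      p ^ x.card * (d - p) ^ (n - x.card) := by
  have h := card_positions_eq (fun a : Fin d => (a : ℕ) < p) x
  rwa [card_val_lt hp, card_not_val_lt hp] at h

lemma card_highPositions_eq (hq : q ≤ d) (x : Finset (Fin n)) :
    Fintype.card {j : Fin n → Fin d // highPositions q j = x} =
      (d - q) ^ x.card * q ^ (n - x.card) := by
  have h := card_positions_eq (fun a : Fin d => ¬ (a : ℕ) < q) x
  simp only [not_not] at h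
  rwa [card_val_lt hq, card_not_val_lt hq] at h

lemma card_subtype_comp_eq_sum {α β : Type*} [Fintype α] [Fintype β] [DecidableEq β]
    (f : α → β) (P : β → Prop) [DecidablePred P] :
    Fintype.card {a // P (f a)} =
      ∑ x ∈ Finset.univ.filter P, Fintype.card {a // f a = x} := by
  classical
  rw [Fintype.card_subtype, Finset.card_eq_sum_card_fiberwise (f := f)
    (t := Finset.univ.filter P) (fun a ha => by simpa using ha)]
  refine Finset.sum_congr rfl fun x hx => ?_
  rw [Fintype.card_subtype, Finset.filter_filter]
  congr 1
  ext a
  simp only [Finset.mem_filter, Finset.mem_univ, true_and] at hx ⊢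
  exact ⟨fun h => h.2, fun h => ⟨h ▸ hx, h⟩⟩

lemma mrk_tensorPow_compSpace_le (hp : p ≤ d) (hq : q ≤ d) (t : ℝ) :
    mrk (tensorPow (compSpace p q d d) n) ≤
      ∑ x : Finset (Fin n), if t ≤ x.card then p ^ x.card * (d - p) ^ (n - x.card)
        else (d - q) ^ x.card * q ^ (n - x.card) := by
  classical
  refine mrk_le fun M hM => ?_
  refine (rank_le_card_add_card M (fun i => t ≤ (lowPositions p i).card)
    (fun j => ¬ t ≤ (highPositions q j).card) fun i j hi hj => ?_).trans_eq ?_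
  · rw [not_not] at hj
    have hlt : (lowPositions p i).card < (highPositions q j).card := by
      exact_mod_cast (not_le.1 hi).trans_le hj
    obtain ⟨k, hk, hk'⟩ := Finset.exists_mem_notMem_of_card_lt_card hlt
    simp only [lowPositions, highPositions, Finset.mem_filter, Finset.mem_univ, true_and,
      not_lt] at hk hk'
    exact apply_eq_zero_of_mem_tensorPow_compSpace hM hk' hk
  · rw [card_subtype_comp_eq_sum (lowPositions p) fun x => t ≤ x.card,
      card_subtype_comp_eq_sum (highPositions q) fun x => ¬ t ≤ x.card, Finset.sum_ite]
    simp only [card_lowPositions_eq hp, card_highPositions_eq hq]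

lemma le_mrk_tensorPow_compSpace (hp : p ≤ d) (hq : q ≤ d) :
    ∑ x : Finset (Fin n), min (p ^ x.card * (d - p) ^ (n - x.card))
        ((d - q) ^ x.card * q ^ (n - x.card)) ≤
      mrk (tensorPow (compSpace p q d d) n) := by
  classical
  let s : Finset (Fin n) → ℕ := fun x => min (p ^ x.card * (d - p) ^ (n - x.card))
        ((d - q) ^ x.card * q ^ (n - x.card))
  have hr : ∀ x : Finset (Fin n),
      Nonempty (Fin (s x) ↪ {i : Fin n → Fin d // lowPositions p i = x}) := fun x =>
    Function.Embedding.nonempty_of_card_le (by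
      rw [Fintype.card_fin, card_lowPositions_eq hp]; exact min_le_left _ _)
  have hc : ∀ x : Finset (Fin n),
      Nonempty (Fin (s x) ↪ {j : Fin n → Fin d // highPositions q j = x}) := fun x =>
    Function.Embedding.nonempty_of_card_le (by
      rw [Fintype.card_fin, card_highPositions_eq hq]; exact min_le_right _ _)
  let r := fun x => (hr x).some
  let c := fun x => (hc x).some
  have key : Fintype.card (Σ x, Fin (s x)) ≤ mrk (tensorPow (compSpace p q d d) n) := by
    refine card_le_mrk (fun a => (r a.1 a.2).1) (fun a => (c a.1 a.2).1) ?_ ?_ ?_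
    · rintro ⟨x, a⟩ ⟨y, b⟩ h
      obtain rfl : x = y := by
        rw [← (r x a).2, ← (r y b).2]; exact congrArg _ h
      exact congrArg _ ((r x).injective (Subtype.ext h))
    · rintro ⟨x, a⟩ ⟨y, b⟩ h
      obtain rfl : x = y := by
        rw [← (c x a).2, ← (c y b).2]; exact congrArg _ h
      exact congrArg _ ((c x).injective (Subtype.ext h))
    · rintro ⟨x, a⟩
      refine single_mem_tensorPow_compSpace fun k => ?_
      by_cases hk : k ∈ x
      · left
        have h := hk
        rw [← (r x a).2] at h
        simpa [lowPositions] using h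
      · right
        have h := hk
        rw [← (c x a).2] at h
        simpa [highPositions] using h
  simpa [Fintype.card_sigma] using key

end Support

section Asymptotics

lemma bernstein_sum_sq_sub (n : ℕ) (θ : ℝ) :
    ∑ x : Finset (Fin n), ((x.card : ℝ) - n * θ) ^ 2 *
      (θ ^ x.card * (1 - θ) ^ (n - x.card)) = n * θ * (1 - θ) := by
  have h := congrArg (Polynomial.eval θ) (bernsteinPolynomial.variance ℝ n)
  have h2 := Finset.sum_powerset_apply_card
    (fun k => ((k : ℝ) - n * θ) ^ 2 * (θ ^ k * (1 - θ) ^ (n - k)))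
    (x := (Finset.univ : Finset (Fin n)))
  rw [Finset.powerset_univ] at h2
  rw [h2, Finset.card_univ, Fintype.card_fin]
  simp only [Polynomial.eval_finsetSum, bernsteinPolynomial, nsmul_eq_mul, Polynomial.eval_mul,
    Polynomial.eval_pow, Polynomial.eval_sub, Polynomial.eval_natCast, Polynomial.eval_X,
    Polynomial.eval_one] at h
  rw [← h]
  refine Finset.sum_congr rfl fun k _ => ?_
  rw [nsmul_eq_mul]
  ring

lemma pow_mul_pow_eq_exp {θ x y : ℝ} (hθ : 0 < θ) (hθ' : 0 < 1 - θ) (hx : 0 < x) (hy : 0 < y)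
    {n t : ℕ} (ht : t ≤ n) :
    x ^ t * y ^ (n - t) = θ ^ t * (1 - θ) ^ (n - t) *
      (Real.exp (n * (θ * Real.log (x / θ) + (1 - θ) * Real.log (y / (1 - θ)))) *
      Real.exp ((t - n * θ) * (Real.log (x / θ) - Real.log (y / (1 - θ))))) := by
  have h : Real.exp (n * (θ * Real.log (x / θ) + (1 - θ) * Real.log (y / (1 - θ)))) *
      Real.exp ((t - n * θ) * (Real.log (x / θ) - Real.log (y / (1 - θ)))) =
      (x / θ) ^ t * (y / (1 - θ)) ^ (n - t) := by
    rw [← Real.exp_add, ← Real.exp_log (pow_pos (div_pos hx hθ) t),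
      ← Real.exp_log (pow_pos (div_pos hy hθ') (n - t)), ← Real.exp_add, Real.log_pow,
      Real.log_pow, Nat.cast_sub ht]
    congr 1
    ring
  rw [h, div_pow, div_pow]
  field_simp

lemma tendsto_rpow_inv_of_exp_bounds {u : ℕ → ℝ} {c v K : ℝ} (hc : 0 < c)
    (hl : ∀ n : ℕ, 1 ≤ n → Real.exp (n * v) * (Real.exp (-K * √n) * c) ≤ u n)
    (hu : ∀ n : ℕ, 1 ≤ n → u n ≤ Real.exp (n * v)) :
    Tendsto (fun n : ℕ => u n ^ ((n : ℝ)⁻¹)) atTop (𝓝 (Real.exp v)) := by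
  have hlim : Tendsto (fun n : ℕ => Real.exp (v + (-K * (√(n : ℝ))⁻¹ + Real.log c * (n : ℝ)⁻¹)))
      atTop (𝓝 (Real.exp v)) := by
    refine (Real.continuous_exp.tendsto _).comp ?_
    have h1 : Tendsto (fun n : ℕ => (√(n : ℝ))⁻¹) atTop (𝓝 0) :=
      tendsto_inv_atTop_zero.comp (Real.tendsto_sqrt_atTop.comp tendsto_natCast_atTop_atTop)
    have h2 : Tendsto (fun n : ℕ => (n : ℝ)⁻¹) atTop (𝓝 0) :=
      tendsto_inv_atTop_zero.comp tendsto_natCast_atTop_atTop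
    simpa using ((h1.const_mul (-K)).add (h2.const_mul (Real.log c))).const_add v
  refine tendsto_of_tendsto_of_tendsto_of_le_of_le' hlim tendsto_const_nhds ?_ ?_
  · filter_upwards [eventually_ge_atTop 1] with n hn
    have hn' : (0 : ℝ) < n := by exact_mod_cast hn
    refine le_trans (le_of_eq ?_) (Real.rpow_le_rpow (by positivity) (hl n hn) (by positivity))
    nth_rewrite 2 [← Real.exp_log hc]
    rw [← Real.exp_add, ← Real.exp_add, ← Real.exp_mul]
    congr 1
    have hs : √(n : ℝ) * (n : ℝ)⁻¹ = (√(n : ℝ))⁻¹ := by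
      have := Real.sq_sqrt hn'.le
      have h0 := Real.sqrt_pos.2 hn'
      field_simp
      linarith
    rw [← hs]
    field_simp
  · filter_upwards [eventually_ge_atTop 1] with n hn
    have hn' : (0 : ℝ) < n := by exact_mod_cast hn
    have h0 : 0 ≤ u n := le_trans (by positivity) (hl n hn)
    refine (Real.rpow_le_rpow h0 (hu n hn) (by positivity)).trans_eq ?_
    rw [← Real.exp_mul]
    congr 1
    field_simp

/-- A sequence squeezed between the sum of the minima of two families of binomial weights and the
sum that switches between them at `n * θ` has growth rate `exp v`, where `v` is the common
exponential rate of both families at the critical bias `θ`. -/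
lemma tendsto_rpow_inv_of_sum_bounds {u : ℕ → ℝ} {θ x₁ y₁ x₂ y₂ v : ℝ}
    (hθ : 0 < θ) (hθ' : 0 < 1 - θ) (hx₁ : 0 < x₁) (hy₁ : 0 < y₁) (hx₂ : 0 < x₂) (hy₂ : 0 < y₂)
    (hv₁ : θ * Real.log (x₁ / θ) + (1 - θ) * Real.log (y₁ / (1 - θ)) = v)
    (hv₂ : θ * Real.log (x₂ / θ) + (1 - θ) * Real.log (y₂ / (1 - θ)) = v)
    (h₁ : Real.log (x₁ / θ) ≤ Real.log (y₁ / (1 - θ)))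
    (h₂ : Real.log (y₂ / (1 - θ)) ≤ Real.log (x₂ / θ))
    (hl : ∀ n : ℕ, ∑ s : Finset (Fin n), min (x₁ ^ s.card * y₁ ^ (n - s.card))
      (x₂ ^ s.card * y₂ ^ (n - s.card)) ≤ u n)
    (hu : ∀ n : ℕ, u n ≤ ∑ s : Finset (Fin n), if n * θ ≤ s.card
      then x₁ ^ s.card * y₁ ^ (n - s.card) else x₂ ^ s.card * y₂ ^ (n - s.card)) :
    Tendsto (fun n : ℕ => u n ^ ((n : ℝ)⁻¹)) atTop (𝓝 (Real.exp v)) := by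
  have hcard : ∀ {n : ℕ} (s : Finset (Fin n)), s.card ≤ n := fun s => by
    simpa using s.card_le_univ
  have hsum : ∀ n : ℕ, ∑ s : Finset (Fin n), θ ^ s.card * (1 - θ) ^ (n - s.card) = 1 := fun n => by
    rw [Fin.sum_pow_mul_eq_add_pow]; simp
  set r₁ := Real.log (x₁ / θ) - Real.log (y₁ / (1 - θ)) with hr₁
  set r₂ := Real.log (x₂ / θ) - Real.log (y₂ / (1 - θ)) with hr₂
  have hr₁0 : r₁ ≤ 0 := by linarith
  have hr₂0 : 0 ≤ r₂ := by linarith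
  refine tendsto_rpow_inv_of_exp_bounds (c := 1 - θ * (1 - θ)) (K := r₂ - r₁)
    (by nlinarith) (fun n hn => le_trans ?_ (hl n)) (fun n hn => (hu n).trans ?_)
  · have hn' : (0 : ℝ) < n := by exact_mod_cast hn
    have hc : (1 - θ * (1 - θ)) = ∑ s : Finset (Fin n),
        (1 - ((s.card : ℝ) - n * θ) ^ 2 / n) * (θ ^ s.card * (1 - θ) ^ (n - s.card)) := by
      simp only [sub_mul, one_mul, div_mul_eq_mul_div]
      rw [Finset.sum_sub_distrib, hsum, ← Finset.sum_div]
      rw [bernstein_sum_sq_sub]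
      field_simp
    rw [hc, Finset.mul_sum, Finset.mul_sum]
    refine Finset.sum_le_sum fun s _ => ?_
    rw [pow_mul_pow_eq_exp hθ hθ' hx₁ hy₁ (hcard s), pow_mul_pow_eq_exp hθ hθ' hx₂ hy₂ (hcard s),
      hv₁, hv₂, ← hr₁, ← hr₂]
    set w := (s.card : ℝ) - n * θ with hw
    have key : ∀ r : ℝ, |r| ≤ r₂ - r₁ →
        Real.exp (-(r₂ - r₁) * √n) * (1 - w ^ 2 / n) ≤ Real.exp (w * r) := by
      intro r hr
      rcases le_or_gt (w ^ 2) n with h | h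
      · have hw' : |w| ≤ √n := Real.abs_le_sqrt h
        have : -(r₂ - r₁) * √n ≤ w * r := by
          have h1 : |w * r| ≤ √n * (r₂ - r₁) := by
            rw [abs_mul]; exact mul_le_mul hw' hr (abs_nonneg _) (Real.sqrt_nonneg _)
          linarith [neg_abs_le (w * r)]
        refine (mul_le_of_le_one_right (Real.exp_pos _).le ?_).trans (Real.exp_le_exp.2 this)
        have : 0 ≤ w ^ 2 / n := by positivity
        linarith
      · refine le_trans (mul_nonpos_of_nonneg_of_nonpos (Real.exp_pos _).le ?_) (Real.exp_pos _).le
        have : 1 < w ^ 2 / n := by rwa [lt_div_iff₀ hn', one_mul]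
        linarith
    have hB : 0 ≤ θ ^ s.card * (1 - θ) ^ (n - s.card) := by positivity
    have hV := (Real.exp_pos (n * v)).le
    refine le_min ?_ ?_
    · have := key r₁ (abs_le.2 ⟨by linarith, by linarith⟩)
      calc _ = θ ^ s.card * (1 - θ) ^ (n - s.card) * (Real.exp (n * v) *
            (Real.exp (-(r₂ - r₁) * √n) * (1 - w ^ 2 / n))) := by ring
        _ ≤ _ := by gcongr
    · have := key r₂ (abs_le.2 ⟨by linarith, by linarith⟩)
      calc _ = θ ^ s.card * (1 - θ) ^ (n - s.card) * (Real.exp (n * v) *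
            (Real.exp (-(r₂ - r₁) * √n) * (1 - w ^ 2 / n))) := by ring
        _ ≤ _ := by gcongr
  · calc _ ≤ ∑ s : Finset (Fin n), θ ^ s.card * (1 - θ) ^ (n - s.card) * Real.exp (n * v) := by
          refine Finset.sum_le_sum fun s _ => ?_
          have hB : 0 ≤ θ ^ s.card * (1 - θ) ^ (n - s.card) := by positivity
          have hV := (Real.exp_pos (n * v)).le
          split_ifs with h
          · rw [pow_mul_pow_eq_exp hθ hθ' hx₁ hy₁ (hcard s), hv₁, ← hr₁]
            refine mul_le_mul_of_nonneg_left (mul_le_of_le_one_right hV ?_) hB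
            exact Real.exp_le_one_iff.2 (mul_nonpos_of_nonneg_of_nonpos (by linarith) hr₁0)
          · rw [pow_mul_pow_eq_exp hθ hθ' hx₂ hy₂ (hcard s), hv₂, ← hr₂]
            refine mul_le_mul_of_nonneg_left (mul_le_of_le_one_right hV ?_) hB
            exact Real.exp_le_one_iff.2
              (mul_nonpos_of_nonpos_of_nonneg (by linarith [not_le.1 h]) hr₂0)
      _ = Real.exp (n * v) := by rw [← Finset.sum_mul, hsum, one_mul]

end Asymptotics

section Entropy

lemma mul_two_rpow_neg_binD {θ x d : ℝ} (hθ : 0 < θ) (hθ' : 0 < 1 - θ) (hx : 0 < x)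
    (hxd : x < d) :
    d * (2 : ℝ) ^ (-(binD θ (x / d))) =
      Real.exp (θ * Real.log (x / θ) + (1 - θ) * Real.log ((d - x) / (1 - θ))) := by
  have hd : 0 < d := hx.trans hxd
  have hdx : 0 < d - x := sub_pos.2 hxd
  have h2 : Real.log 2 ≠ 0 := (Real.log_pos one_lt_two).ne'
  have e : 1 - x / d = (d - x) / d := by field_simp
  rw [Real.rpow_def_of_pos two_pos]
  nth_rewrite 1 [← Real.exp_log hd]
  rw [← Real.exp_add, binD, e, Real.logb, Real.logb,
    Real.log_div hθ.ne' (by positivity), Real.log_div hθ'.ne' (by positivity),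
    Real.log_div hx.ne' hd.ne', Real.log_div hdx.ne' hd.ne', Real.log_div hx.ne' hθ.ne',
    Real.log_div hdx.ne' hθ'.ne']
  congr 1
  field_simp
  ring

/-- The weighted inequality `(d - y) log ((d - y) / x) + y log (y / (d - x)) ≥ 0`. -/
lemma mul_log_sub_le {x y d : ℝ} (hx : 0 < x) (hy : 0 < y) (h : x + y < d) :
    y * (Real.log (d - x) - Real.log y) ≤ (d - y) * (Real.log (d - y) - Real.log x) := by
  have hdx : 0 < d - x := by linarith
  have hdy : 0 < d - y := by linarith
  have h1 := Real.log_le_sub_one_of_pos (div_pos hx hdy)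
  have h2 := Real.log_le_sub_one_of_pos (div_pos hdx hy)
  rw [Real.log_div hx.ne' hdy.ne'] at h1
  rw [Real.log_div hdx.ne' hy.ne'] at h2
  have e1 : (d - y) * (x / (d - y) - 1) = x - (d - y) := by field_simp
  have e2 : y * ((d - x) / y - 1) = d - x - y := by field_simp
  have := mul_le_mul_of_nonneg_left h1 hdy.le
  have := mul_le_mul_of_nonneg_left h2 hy.le
  linarith

end Entropy

theorem stmt18 {p q d : ℕ} (hp : 1 ≤ p) (hq : 1 ≤ q) (hpq : p + q < d)
    (p' q' α : ℝ) (hp' : p' = (p : ℝ) / d) (hq' : q' = (q : ℝ) / d)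
    (hα : α = (Real.logb 2 ((d : ℝ) - q) - Real.logb 2 p) /
        (Real.logb 2 (((d : ℝ) - p) * ((d : ℝ) - q)) - Real.logb 2 ((p : ℝ) * q))) :
    Filter.Tendsto
      (fun n : ℕ => (mrk (tensorPow (compSpace p q d d) n) : ℝ) ^ ((n : ℝ)⁻¹))
      Filter.atTop
      (nhds ((d : ℝ) *
        max ((2 : ℝ) ^ (-(binD (1 - α) p'))) ((2 : ℝ) ^ (-(binD α q'))))) := by
  have hp0 : (0 : ℝ) < p := by exact_mod_cast hp
  have hq0 : (0 : ℝ) < q := by exact_mod_cast hq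
  have hd : (p : ℝ) + q < d := by exact_mod_cast hpq
  have hdp : (0 : ℝ) < d - p := by linarith
  have hdq : (0 : ℝ) < d - q := by linarith
  have h2 : 0 < Real.log 2 := Real.log_pos one_lt_two
  obtain ⟨a, ha⟩ : ∃ a, a = Real.log (d - q : ℝ) - Real.log p := ⟨_, rfl⟩
  obtain ⟨b, hb⟩ : ∃ b, b = Real.log (d - p : ℝ) - Real.log q := ⟨_, rfl⟩
  have ha0 : 0 < a := ha ▸ sub_pos.2 (Real.log_lt_log hp0 (by linarith))
  have hb0 : 0 < b := hb ▸ sub_pos.2 (Real.log_lt_log hq0 (by linarith))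
  have hα' : α = a / (a + b) := by
    rw [hα, Real.logb_mul hdp.ne' hdq.ne', Real.logb_mul hp0.ne' hq0.ne', ha, hb]
    simp only [Real.logb]
    rw [← sub_div, ← add_div, ← add_div, ← sub_div, div_div_div_cancel_right₀ h2.ne']
    congr 1
    ring
  have hα0 : 0 < α := hα' ▸ by positivity
  have hθ : 1 - α = b / (a + b) := by rw [hα']; field_simp; ring
  have hθ0 : 0 < 1 - α := hθ ▸ by positivity
  have hαe : 1 - (1 - α) = α := sub_sub_cancel _ _
  have hbal : (1 - α) * a = α * b := by rw [hθ, hα']; ring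
  have hv : (1 - α) * Real.log ((d - q) / (1 - α)) + α * Real.log (q / α) =
      (1 - α) * Real.log (p / (1 - α)) + α * Real.log ((d - p) / α) := by
    rw [Real.log_div hdq.ne' hθ0.ne', Real.log_div hq0.ne' hα0.ne', Real.log_div hp0.ne' hθ0.ne',
      Real.log_div hdp.ne' hα0.ne']
    rw [ha, hb] at hbal
    linarith
  have hpα : (p : ℝ) * α ≤ (d - p) * (1 - α) := by
    have := mul_log_sub_le hq0 hp0 (by linarith : (q : ℝ) + p < d)
    rw [hθ, hα', mul_div_assoc', mul_div_assoc']
    rw [← ha, ← hb] at this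
    gcongr
  have hqα : (q : ℝ) * (1 - α) ≤ (d - q) * α := by
    have := mul_log_sub_le hp0 hq0 hd
    rw [hθ, hα', mul_div_assoc', mul_div_assoc']
    rw [← ha, ← hb] at this
    gcongr
  have e1 := mul_two_rpow_neg_binD (θ := 1 - α) (x := p) (d := d) hθ0 (by rwa [hαe]) hp0
    (by linarith)
  have e2 := mul_two_rpow_neg_binD (θ := α) (x := q) (d := d) hα0 hθ0 hq0 (by linarith)
  rw [hαe] at e1
  rw [add_comm, hv] at e2
  rw [mul_max_of_nonneg _ _ (Nat.cast_nonneg d), hp', hq', e1, e2, max_self]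
  have hdp' : ((d - p : ℕ) : ℝ) = d - p := Nat.cast_sub (by omega)
  have hdq' : ((d - q : ℕ) : ℝ) = d - q := Nat.cast_sub (by omega)
  refine tendsto_rpow_inv_of_sum_bounds (θ := 1 - α) (x₁ := p) (y₁ := d - p) (x₂ := d - q)
    (y₂ := q) hθ0 (by rwa [hαe]) hp0 hdp hdq hq0 (by rw [hαe]) (by rw [hαe, hv]) ?_ ?_
    (fun n => ?_) (fun n => ?_)
  · rw [hαe]
    refine Real.log_le_log (by positivity) ?_
    rwa [div_le_div_iff₀ hθ0 hα0]
  · rw [hαe]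
    refine Real.log_le_log (by positivity) ?_
    rwa [div_le_div_iff₀ hα0 hθ0]
  · have h := le_mrk_tensorPow_compSpace (n := n) (show p ≤ d by omega) (show q ≤ d by omega)
    rw [← hdp', ← hdq']
    exact_mod_cast h
  · have h := mrk_tensorPow_compSpace_le (n := n) (show p ≤ d by omega) (show q ≤ d by omega)
      (n * (1 - α))
    rw [← hdp', ← hdq']
    exact_mod_cast h
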